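/- arXiv:1204.5654 — 4 statements merged into one kernel-verified Lean document; each statement's English description precedes it below -/
import Mathlib

section
/- Let β ∈ (−1,0) ∪ (0,∞), a ≠ 0, and a² < C_β. Then f_{a,β}(x,t) > 0 for all (x,t) ∈ ℝ^{2n} × ℝ with (x,t) ≠ (0,0). -/
noncomputable section

/-- `f_{a,β}(x,t) = 2(β+1)|x|⁸ + (3(β+2)−2a²)|x|⁴t² + (β+2)a²t⁴`. -/
def fab (n : ℕ) (a β : ℝ) (x : Fin (2*n) → ℝ) (t : ℝ) : ℝ :=
  2 * (β + 1) * (∑ i, x i ^ 2) ^ 4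
    + (3 * (β + 2) - 2 * a ^ 2) * (∑ i, x i ^ 2) ^ 2 * t ^ 2
    + (β + 2) * a ^ 2 * t ^ 4

/-- The critical constant `C_β = ((β+2)/2)(2β+5+√((2β+5)²−9))`. -/
def Cbeta (β : ℝ) : ℝ :=
  ((β + 2)/2) * (2*β + 5 + Real.sqrt ((2*β + 5)^2 - 9))

theorem quadForm_pos_of_discrim_neg {p q r X T : ℝ} (hp : 0 < p) (hd : q ^ 2 < 4 * p * r)
    (h : X ≠ 0 ∨ T ≠ 0) : 0 < p * X ^ 2 + q * X * T + r * T ^ 2 := by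
  have key : 0 < 4 * p * (p * X ^ 2 + q * X * T + r * T ^ 2) := by
    have e : 4 * p * (p * X ^ 2 + q * X * T + r * T ^ 2)
        = (2 * p * X + q * T) ^ 2 + (4 * p * r - q ^ 2) * T ^ 2 := by ring
    rw [e]
    have hD : 0 < 4 * p * r - q ^ 2 := by linarith
    by_cases hT : T = 0
    · have hX : X ≠ 0 := h.resolve_right (not_not.mpr hT)
      subst hT
      simp only [mul_zero, add_zero, ne_eq, OfNat.ofNat_ne_zero, not_false_eq_true, zero_pow]
      positivity
    · positivity
  exact pos_of_mul_pos_right key (by positivity)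

theorem quadForm_pos_of_nonneg_cross {p q r X T : ℝ} (hp : 0 < p) (hq : 0 ≤ q) (hr : 0 < r)
    (hX : 0 ≤ X) (hT : 0 ≤ T) (h : X ≠ 0 ∨ T ≠ 0) :
    0 < p * X ^ 2 + q * X * T + r * T ^ 2 := by
  rcases h with h | h <;> positivity

/-- Between `3(β+2)/2` and `C_β`, the discriminant of `f_{a,β}`, as a quadratic form in
`|x|⁴` and `t²`, is negative; here `A` stands for `a²`. -/
theorem discrim_neg_of_lt_Cbeta {β A : ℝ} (hβ : -1 < β) (hA : 3 * (β + 2) < 2 * A)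
    (hC : A < Cbeta β) :
    (3 * (β + 2) - 2 * A) ^ 2 < 4 * (2 * (β + 1)) * ((β + 2) * A) := by
  unfold Cbeta at hC
  have hs2 : Real.sqrt ((2*β + 5)^2 - 9) ^ 2 = (2*β + 5)^2 - 9 :=
    Real.sq_sqrt (by nlinarith)
  have hs0 := Real.sqrt_nonneg ((2*β + 5)^2 - 9)
  generalize Real.sqrt ((2*β + 5)^2 - 9) = s at hs2 hs0 hC
  have hs : 2 * β + 5 - s < 3 := by nlinarith
  have hlow : (β + 2) / 2 * (2 * β + 5 - s) < A := by nlinarith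
  have hprod := mul_pos (sub_pos.mpr hC) (sub_pos.mpr hlow)
  have e : (((β + 2) / 2) * (2*β + 5 + s) - A) * (A - (β + 2) / 2 * (2 * β + 5 - s))
      = (4 * (2 * (β + 1)) * ((β + 2) * A) - (3 * (β + 2) - 2 * A) ^ 2) / 4 := by
    linear_combination ((β + 2) ^ 2 / 4) * hs2
  rw [e] at hprod
  linarith

/-- If `β ∈ (−1,0) ∪ (0,∞)` and `a² < C_β`, then `f_{a,β}(x,t) > 0` away from the
origin. -/
theorem fab_pos_subcritical (n : ℕ) (a β : ℝ) (ha : a ≠ 0)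
    (hβ : β ∈ Set.Ioo (-1 : ℝ) 0 ∪ Set.Ioi (0 : ℝ)) (haC : a ^ 2 < Cbeta β) :
    ∀ (x : Fin (2*n) → ℝ) (t : ℝ), (x, t) ≠ (0, 0) → 0 < fab n a β x t := by
  intro x t hxt
  have hβ1 : -1 < β := by
    rcases hβ with h | h
    · exact h.1
    · linarith [Set.mem_Ioi.mp h]
  have hA : 0 < a ^ 2 := by positivity
  have h0 : (∑ i, x i ^ 2) ^ 2 ≠ 0 ∨ t ^ 2 ≠ 0 := by
    by_contra! h
    obtain ⟨hx, ht⟩ := h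
    rw [sq_eq_zero_iff, Finset.sum_eq_zero_iff_of_nonneg fun i _ => sq_nonneg (x i)] at hx
    exact hxt (Prod.ext (funext fun i => sq_eq_zero_iff.mp (hx i (Finset.mem_univ i)))
      (sq_eq_zero_iff.mp ht))
  have hp : 0 < 2 * (β + 1) := by linarith
  have hr : 0 < (β + 2) * a ^ 2 := mul_pos (by linarith) hA
  have e : fab n a β x t = 2 * (β + 1) * ((∑ i, x i ^ 2) ^ 2) ^ 2
      + (3 * (β + 2) - 2 * a ^ 2) * (∑ i, x i ^ 2) ^ 2 * t ^ 2
      + (β + 2) * a ^ 2 * (t ^ 2) ^ 2 := by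
    unfold fab
    ring
  rw [e]
  rcases le_or_gt (2 * a ^ 2) (3 * (β + 2)) with h | h
  · exact quadForm_pos_of_nonneg_cross hp (sub_nonneg.mpr h) hr (sq_nonneg _) (sq_nonneg _) h0
  · exact quadForm_pos_of_discrim_neg hp (discrim_neg_of_lt_Cbeta hβ1 h haC) h0

end
end

section
/- Let β ∈ (−1,0) ∪ (0,∞), a ≠ 0, and a² = C_β. Then there exists a constant c > 0 such that f_{a,β}(x,t) = 2(β+1)(|x|⁴ − c t²)² for all (x,t) ∈ ℝ^{2n} × ℝ. -/
noncomputable section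

/-- If `β ∈ (−1,0) ∪ (0,∞)` and `a² = C_β`, then
`f_{a,β}(x,t) = 2(β+1)(|x|⁴ − c t²)²` for some `c > 0`. -/
theorem fab_square_critical (n : ℕ) (a β : ℝ) (ha : a ≠ 0)
    (hβ : β ∈ Set.Ioo (-1 : ℝ) 0 ∪ Set.Ioi (0 : ℝ)) (haC : a ^ 2 = Cbeta β) :
    ∃ c > (0:ℝ), ∀ (x : Fin (2*n) → ℝ) (t : ℝ),
      fab n a β x t = 2 * (β + 1) * ((∑ i, x i ^ 2) ^ 2 - c * t ^ 2) ^ 2 := by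
  set s := Real.sqrt ((2 * β + 5) ^ 2 - 9)
  have hβ₁ : -1 < β := by
    rcases hβ with h | h
    · exact h.1
    · exact lt_trans (by norm_num) h
  have hs_pos : 0 < s := Real.sqrt_pos.2 (by nlinarith)
  have hs_sq : s ^ 2 = (2 * β + 5) ^ 2 - 9 := Real.sq_sqrt (by nlinarith)
  have hA : a ^ 2 = (β + 2) / 2 * (2 * β + 5 + s) := haC
  have hβ₁_ne : β + 1 ≠ 0 := by linarith
  refine ⟨(β + 2) * (2 * β + 2 + s) / (4 * (β + 1)), ?_, fun x t => ?_⟩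
  · have h₁ : 0 < β + 1 := by linarith
    have h₂ : 0 < β + 2 := by linarith
    have h₃ : 0 < 2 * β + 2 + s := by linarith
    positivity
  · simp only [fab, hA]
    generalize ∑ i, x i ^ 2 = r
    field_simp
    linear_combination (-4 * (β + 2) ^ 2 * t ^ 4) * hs_sq

end
end

section
/- Let β ∈ (−1,0) ∪ (0,∞), a ≠ 0, and a² > C_β. Then there exist constants c₁, c₂ > 0 with c₁ ≠ c₂ such that f_{a,β}(x,t) = 2(β+1)(|x|⁴ − c₁t²)(|x|⁴ − c₂t²) for all (x,t) ∈ ℝ^{2n} × ℝ. In particular, f_{a,β} vanishes on the two distinct cones {|x|⁴ = c₁ t²} and {|x|⁴ = c₂ t²}. -/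
noncomputable section

/-- If `β ∈ (−1,0) ∪ (0,∞)` and `a² > C_β`, then
`f_{a,β}(x,t) = 2(β+1)(|x|⁴ − c₁t²)(|x|⁴ − c₂t²)` for some `c₁ ≠ c₂`, both `> 0`;
in particular `f_{a,β}` vanishes on the two distinct cones `{|x|⁴ = cᵢ t²}`. -/
theorem fab_factor_supercritical (n : ℕ) (a β : ℝ) (ha : a ≠ 0)
    (hβ : β ∈ Set.Ioo (-1 : ℝ) 0 ∪ Set.Ioi (0 : ℝ)) (haC : a ^ 2 > Cbeta β) :
    ∃ c₁ > (0:ℝ), ∃ c₂ > (0:ℝ), c₁ ≠ c₂ ∧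
      (∀ (x : Fin (2*n) → ℝ) (t : ℝ),
        fab n a β x t
          = 2 * (β + 1) * ((∑ i, x i ^ 2) ^ 2 - c₁ * t ^ 2)
              * ((∑ i, x i ^ 2) ^ 2 - c₂ * t ^ 2)) ∧
      (∀ (x : Fin (2*n) → ℝ) (t : ℝ),
        (∑ i, x i ^ 2) ^ 2 = c₁ * t ^ 2 ∨ (∑ i, x i ^ 2) ^ 2 = c₂ * t ^ 2 →
          fab n a β x t = 0) := by
  have hβ' : -1 < β := by
    rcases hβ with h | h
    · exact h.1
    · exact lt_trans (by norm_num) (Set.mem_Ioi.1 h)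
  have hk : 0 < β + 1 := by linarith
  have hb : 0 < β + 2 := by linarith
  have hA : 0 < a ^ 2 := by positivity
  unfold Cbeta at haC
  set A := a ^ 2 with hAdef
  set r := √((2 * β + 5) ^ 2 - 9)
  have hr0 : 0 ≤ r := Real.sqrt_nonneg _
  have hr : r ^ 2 = (2 * β + 5) ^ 2 - 9 := Real.sq_sqrt (by nlinarith)
  have hgap : (β + 2) * r < 2 * A - (β + 2) * (2 * β + 5) := by linarith
  have hbr : 0 ≤ (β + 2) * r := by positivity
  have hB : 0 < 2 * A - 3 * (β + 2) := by nlinarith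
  have hD : 0 < (2 * A - 3 * (β + 2)) ^ 2 - 8 * (β + 1) * ((β + 2) * A) := by
    have hsq := pow_lt_pow_left₀ hgap hbr two_ne_zero
    rw [mul_pow, hr] at hsq
    linarith
  set d := √((2 * A - 3 * (β + 2)) ^ 2 - 8 * (β + 1) * ((β + 2) * A))
  have hd0 : 0 < d := Real.sqrt_pos.2 hD
  have hd : d ^ 2 = (2 * A - 3 * (β + 2)) ^ 2 - 8 * (β + 1) * ((β + 2) * A) :=
    Real.sq_sqrt hD.le
  have hdB : d < 2 * A - 3 * (β + 2) := by
    refine lt_of_pow_lt_pow_left₀ 2 hB.le ?_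
    have : 0 < 8 * (β + 1) * ((β + 2) * A) := by positivity
    linarith
  obtain ⟨c₁, hc₁⟩ : ∃ c, c = (2 * A - 3 * (β + 2) + d) / (4 * (β + 1)) := ⟨_, rfl⟩
  obtain ⟨c₂, hc₂⟩ : ∃ c, c = (2 * A - 3 * (β + 2) - d) / (4 * (β + 1)) := ⟨_, rfl⟩
  have hsum : 2 * (β + 1) * (c₁ + c₂) = 2 * A - 3 * (β + 2) := by
    rw [hc₁, hc₂]; field_simp; ring
  have hprod : 2 * (β + 1) * (c₁ * c₂) = (β + 2) * A := by
    rw [hc₁, hc₂]; field_simp; linear_combination -2 * hd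
  have hfactor : ∀ (x : Fin (2*n) → ℝ) (t : ℝ),
      fab n a β x t
        = 2 * (β + 1) * ((∑ i, x i ^ 2) ^ 2 - c₁ * t ^ 2)
            * ((∑ i, x i ^ 2) ^ 2 - c₂ * t ^ 2) := by
    intro x t
    rw [fab, ← hAdef]
    linear_combination (∑ i, x i ^ 2) ^ 2 * t ^ 2 * hsum - t ^ 4 * hprod
  refine ⟨c₁, ?_, c₂, ?_, ?_, hfactor, ?_⟩
  · rw [hc₁]; exact div_pos (by linarith) (by linarith)
  · rw [hc₂]; exact div_pos (by linarith) (by linarith)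
  · refine ne_of_gt ?_
    rw [hc₁, hc₂]
    exact div_lt_div_of_pos_right (by linarith) (by linarith)
  · rintro x t (h | h) <;> rw [hfactor, h] <;> ring

end
end

section
/- Let β ∈ (−2,−1) and a ≠ 0. Then there exist constants c₁ > 0 and c₃ > 0 such that f_{a,β}(x,t) = 2(β+1)(|x|⁴ − c₁t²)(|x|⁴ + c₃t²) for all (x,t) ∈ ℝ^{2n} × ℝ. In particular, f_{a,β} vanishes exactly on the cone {|x|⁴ = c₁ t²} (away from the origin). -/
noncomputable section

/-- A real quadratic `p s² + q s + r` with `p < 0 < r` has one positive root `c` and one negative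
root `-d`; the identities are Vieta's formulas. -/
theorem exists_pos_roots_of_neg_of_pos {p r : ℝ} (q : ℝ) (hp : p < 0) (hr : 0 < r) :
    ∃ c > (0:ℝ), ∃ d > (0:ℝ), p * (d - c) = q ∧ -(p * (c * d)) = r := by
  have hpr : 0 < -(p * r) := neg_pos.2 (mul_neg_of_neg_of_pos hp hr)
  set S := Real.sqrt (q ^ 2 - 4 * p * r)
  have hSq : S ^ 2 = q ^ 2 - 4 * p * r := Real.sq_sqrt (by nlinarith [sq_nonneg q])
  have hqS : |q| < S := by
    rw [← Real.sqrt_sq_eq_abs]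
    exact Real.sqrt_lt_sqrt (sq_nonneg q) (by linarith)
  obtain ⟨h₁, h₂⟩ := abs_lt.1 hqS
  have hp' : p ≠ 0 := hp.ne
  refine ⟨(q + S) / (-2 * p), div_pos (by linarith) (by linarith),
    (S - q) / (-2 * p), div_pos (by linarith) (by linarith), ?_, ?_⟩
  · field_simp
    ring
  · field_simp
    linear_combination -hSq

/-- If `β ∈ (−2,−1)`, then `f_{a,β}(x,t) = 2(β+1)(|x|⁴ − c₁t²)(|x|⁴ + c₃t²)` for
some `c₁, c₃ > 0`; in particular, away from the origin, `f_{a,β}` vanishes exactly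
on the cone `{|x|⁴ = c₁ t²}`. -/
theorem fab_factor_beta_between (n : ℕ) (a β : ℝ) (ha : a ≠ 0)
    (hβ : β ∈ Set.Ioo (-2 : ℝ) (-1 : ℝ)) :
    ∃ c₁ > (0:ℝ), ∃ c₃ > (0:ℝ),
      (∀ (x : Fin (2*n) → ℝ) (t : ℝ),
        fab n a β x t
          = 2 * (β + 1) * ((∑ i, x i ^ 2) ^ 2 - c₁ * t ^ 2)
              * ((∑ i, x i ^ 2) ^ 2 + c₃ * t ^ 2)) ∧
      (∀ (x : Fin (2*n) → ℝ) (t : ℝ), (x, t) ≠ (0, 0) →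
        (fab n a β x t = 0 ↔ (∑ i, x i ^ 2) ^ 2 = c₁ * t ^ 2)) := by
  obtain ⟨h₁, h₂⟩ := hβ
  have hp : 2 * (β + 1) < 0 := by linarith
  have hr : 0 < (β + 2) * a ^ 2 := mul_pos (by linarith) (by positivity)
  obtain ⟨c, hc, d, hd, hsum, hprod⟩ :=
    exists_pos_roots_of_neg_of_pos (3 * (β + 2) - 2 * a ^ 2) hp hr
  have hfactor (x : Fin (2*n) → ℝ) (t : ℝ) :
      fab n a β x t = 2 * (β + 1) * ((∑ i, x i ^ 2) ^ 2 - c * t ^ 2)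
        * ((∑ i, x i ^ 2) ^ 2 + d * t ^ 2) := by
    unfold fab
    linear_combination -(∑ i, x i ^ 2) ^ 2 * t ^ 2 * hsum - t ^ 4 * hprod
  refine ⟨c, hc, d, hd, hfactor, fun x t hxt => ?_⟩
  have hpos : (∑ i, x i ^ 2) ^ 2 + d * t ^ 2 ≠ 0 := by
    intro h
    obtain ⟨hx, ht⟩ := (add_eq_zero_iff_of_nonneg (by positivity) (by positivity)).1 h
    have ht0 : t = 0 := by simpa [hd.ne'] using ht
    have hx0 : x = 0 := by
      ext i
      have hi := (Finset.sum_eq_zero_iff_of_nonneg fun j _ => sq_nonneg (x j)).1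
        (pow_eq_zero_iff two_ne_zero |>.1 hx) i (Finset.mem_univ i)
      exact pow_eq_zero_iff two_ne_zero |>.1 hi
    exact hxt (by rw [hx0, ht0])
  rw [hfactor, mul_eq_zero, or_iff_left hpos, mul_eq_zero, or_iff_right hp.ne, sub_eq_zero]

end
end
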